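/- With N and the sequential policy π' as defined, the sequential policy reproduces π: for every subset ε ⊆ {1,…,m} of cardinality p, summing over all p! orderings (j_1, …, j_p) of the elements of ε (i.e., over all duplicate-free lists whose underlying set is ε) gives Σ_{orderings} π'(j_1 | ∅) · π'(j_2 | {j_1}) · ⋯ · π'(j_p | {j_1,…,j_{p−1}}) · π'(† | ε) = π(ε). -/

import Mathlib

/-- `N π ε = Σ_{A ⊇ ε} π(A) · |ε|! · (|A| − |ε|)! / |A|!`, the sum over all
subsets `A` of `Fin m` containing `ε`. -/
noncomputable def N {m : ℕ} (π : Finset (Fin m) → ℝ) (ε : Finset (Fin m)) : ℝ :=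
  ∑ A ∈ Finset.univ.filter (fun A => ε ⊆ A),
    π A * (Nat.factorial ε.card : ℝ) * (Nat.factorial (A.card - ε.card) : ℝ) /
      (Nat.factorial A.card : ℝ)

/-- The sequential policy `π'` induced by `π`: given the already-chosen set `ε`,
`some j` is chosen with probability `(1/N(ε)) · Σ_{A ⊇ ε ∪ {j}} π(A) · |ε|! · (|A|−|ε|−1)! / |A|!`
(for `j ∉ ε`), and the termination symbol `†` (here `none`) with probability `π(ε)/N(ε)`. -/
noncomputable def seqPolicy {m : ℕ} (π : Finset (Fin m) → ℝ) (ε : Finset (Fin m)) :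
    Option (Fin m) → ℝ
  | none => π ε / N π ε
  | some j =>
      (1 / N π ε) *
        ∑ A ∈ Finset.univ.filter (fun A => insert j ε ⊆ A),
          π A * (Nat.factorial ε.card : ℝ) * (Nat.factorial (A.card - ε.card - 1) : ℝ) /
            (Nat.factorial A.card : ℝ)

/-- Given a policy `q` (where `q ε (some j)` is the probability of choosing `j` next
and `q ε none` that of terminating), `seqProd q ε (j₁ :: ⋯ :: jₚ :: [])` is the product
`q(j₁ | ε) · q(j₂ | ε ∪ {j₁}) · ⋯ · q(jₚ | ε ∪ {j₁,…,j_{p−1}}) · q(† | ε ∪ {j₁,…,jₚ})`. -/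
noncomputable def seqProd {m : ℕ} (q : Finset (Fin m) → Option (Fin m) → ℝ) :
    Finset (Fin m) → List (Fin m) → ℝ
  | ε, [] => q ε none
  | ε, j :: L => q ε (some j) * seqProd q (insert j ε) L

open scoped Nat

lemma N_pos {m : ℕ} {π : Finset (Fin m) → ℝ} (hpos : ∀ A, 0 < π A) (ε : Finset (Fin m)) :
    0 < N π ε := by
  refine Finset.sum_pos (fun A _ => ?_) ⟨ε, by simp⟩
  have := hpos A
  positivity

lemma N_empty {m : ℕ} (π : Finset (Fin m) → ℝ) : N π ∅ = ∑ A, π A := by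
  simp [N, Nat.factorial_ne_zero]

lemma seqPolicy_some {m : ℕ} (π : Finset (Fin m) → ℝ) {ε : Finset (Fin m)} {j : Fin m}
    (hj : j ∉ ε) :
    seqPolicy π ε (some j) = N π (insert j ε) / (N π ε * (ε.card + 1)) := by
  have key : (∑ A ∈ Finset.univ.filter (fun A => insert j ε ⊆ A),
      π A * (ε.card ! : ℝ) * ((A.card - ε.card - 1)! : ℝ) / (A.card ! : ℝ)) =
      N π (insert j ε) / (ε.card + 1) := by
    rw [N, Finset.sum_div, Finset.card_insert_of_notMem hj]
    refine Finset.sum_congr rfl fun A _ => ?_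
    rw [Nat.factorial_succ, Nat.sub_sub]
    push_cast
    field_simp
  rw [seqPolicy, key, one_div_mul_eq_div, div_div, mul_comm (N π ε)]

lemma seqProd_seqPolicy {m : ℕ} {π : Finset (Fin m) → ℝ} (hpos : ∀ A, 0 < π A)
    (L : List (Fin m)) (ε : Finset (Fin m)) (hL : L.Nodup) (hd : ∀ j ∈ L, j ∉ ε) :
    seqProd (seqPolicy π) ε L =
      π (ε ∪ L.toFinset) * (ε.card ! : ℝ) / (N π ε * ((ε.card + L.length)! : ℝ)) := by
  induction L generalizing ε with
  | nil =>
    have := (N_pos hpos ε).ne'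
    simp only [seqProd, seqPolicy, List.toFinset_nil, Finset.union_empty, List.length_nil,
      add_zero]
    field_simp
  | cons j L ih =>
    rw [List.nodup_cons] at hL
    have hj : j ∉ ε := hd j (by simp)
    have hd' : ∀ k ∈ L, k ∉ insert j ε := fun k hk => by
      rw [Finset.mem_insert, not_or]
      exact ⟨fun h => hL.1 (h ▸ hk), hd k (by simp [hk])⟩
    have h₁ := (N_pos hpos ε).ne'
    have h₂ := (N_pos hpos (insert j ε)).ne'
    rw [seqProd, seqPolicy_some π hj, ih _ hL.2 hd', Finset.card_insert_of_notMem hj,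
      List.toFinset_cons, Finset.union_insert, Finset.insert_union, List.length_cons,
      Nat.factorial_succ, add_right_comm, ← add_assoc]
    push_cast
    field_simp

/-- The sequential policy reproduces `π`: for every `ε ⊆ Fin m`, summing the product
`π'(j₁ | ∅) · π'(j₂ | {j₁}) · ⋯ · π'(jₚ | {j₁,…,j_{p−1}}) · π'(† | ε)` over all
`p!` orderings `(j₁, …, jₚ)` of the elements of `ε` (the permutations of a listing of
`ε`, i.e. all duplicate-free lists with underlying set `ε`) gives `π(ε)`. -/
theorem sum_seqProd_eq_pi (m : ℕ) (hm : 1 ≤ m) (π : Finset (Fin m) → ℝ)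
    (hpos : ∀ A : Finset (Fin m), 0 < π A)
    (hsum : ∑ A : Finset (Fin m), π A = 1) :
    ∀ ε : Finset (Fin m),
      ((ε.toList.permutations).map (fun L => seqProd (seqPolicy π) ∅ L)).sum = π ε := by
  intro ε
  have h : ∀ L ∈ ε.toList.permutations,
      seqProd (seqPolicy π) ∅ L = π ε / (ε.card ! : ℝ) := fun L hL => by
    have hp := List.mem_permutations.1 hL
    rw [seqProd_seqPolicy hpos L ∅ (hp.nodup_iff.2 ε.nodup_toList) (by simp), N_empty, hsum,
      List.toFinset_eq_of_perm _ _ hp, hp.length_eq]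
    simp
  rw [List.map_congr_left h, List.map_const', List.sum_replicate, List.length_permutations,
    Finset.length_toList, nsmul_eq_mul]
  field_simp
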